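/- arXiv:2509.02832 — 2 statements merged into one kernel-verified Lean document; each statement's English description precedes it below -/
import Mathlib

section
/- Let M be the direct sum of the uniform matroid U_{4,6} on a 6-element set and the uniform matroid U_{8,9} on a disjoint 9-element set, so M is a matroid on 15 elements whose circuits are the 5-element subsets of the first ground set together with the entire second ground set. Then every circuit C of M satisfies β_C = 1/7; in particular M is equitable, even though its circuits have two different sizes (5 and 9) and hence no automorphism of M can map a circuit of one size to a circuit of the other. -/
open Finset

/-- A matroid presented by its collection of circuits (the valid sets of bingo
cards): nonempty ground set axioms (C1)-(C3) of the paper. -/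
structure BingoMatroid (α : Type*) [DecidableEq α] where
  /-- the ground set -/
  E : Finset α
  /-- the circuits (bingo cards) -/
  circuits : Finset (Finset α)
  subset_ground : ∀ C ∈ circuits, C ⊆ E
  empty_not_mem : ∅ ∉ circuits
  antichain : ∀ C₁ ∈ circuits, ∀ C₂ ∈ circuits, C₁ ⊆ C₂ → C₁ = C₂
  elimination : ∀ C₁ ∈ circuits, ∀ C₂ ∈ circuits, C₁ ≠ C₂ →
    ∀ e ∈ C₁ ∩ C₂, ∃ C₃ ∈ circuits, C₃ ⊆ (C₁ ∪ C₂) \ {e}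

/-- The completion time `t_C(σ)`: the least `t` such that every element of `C`
has been called out among the first `t` values of `σ`. -/
noncomputable def hitTime {α : Type*} {n : ℕ} (σ : Fin n → α) (C : Finset α) : ℕ :=
  sInf {t : ℕ | ∀ x ∈ C, ∃ i : Fin n, (i : ℕ) < t ∧ σ i = x}

namespace BingoMatroid

variable {α : Type*} [DecidableEq α]

/-- `C` wins the bingo game under calling order `σ`: it is completed strictly
before every other circuit. -/
def Wins (M : BingoMatroid α) (σ : Fin M.E.card ≃ {x // x ∈ M.E}) (C : Finset α) : Prop :=
  ∀ C' ∈ M.circuits, C' ≠ C →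
    hitTime (fun i => (σ i : α)) C < hitTime (fun i => (σ i : α)) C'

/-- The winning probability `β_C`: the number of calling orders under which `C`
wins, divided by `n!`. -/
noncomputable def beta (M : BingoMatroid α) (C : Finset α) : ℚ :=
  (Nat.card {σ : Fin M.E.card ≃ {x // x ∈ M.E} // M.Wins σ C} : ℚ) /
    (Nat.factorial M.E.card : ℚ)

/-- The timed winning probability `β_C(t)`: the probability that `C` wins and is
completed exactly in round `t`. -/
noncomputable def betaT (M : BingoMatroid α) (C : Finset α) (t : ℕ) : ℚ :=
  (Nat.card {σ : Fin M.E.card ≃ {x // x ∈ M.E} //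
      M.Wins σ C ∧ hitTime (fun i => (σ i : α)) C = t} : ℚ) /
    (Nat.factorial M.E.card : ℚ)

/-- A set is independent if it is contained in the ground set and contains no circuit. -/
def Indep (M : BingoMatroid α) (I : Finset α) : Prop :=
  I ⊆ M.E ∧ ∀ C ∈ M.circuits, ¬ C ⊆ I

/-- The rank of the matroid: the maximum size of an independent set. -/
noncomputable def rank (M : BingoMatroid α) : ℕ :=
  sSup {k : ℕ | ∃ I : Finset α, M.Indep I ∧ I.card = k}

/-- A basis is a maximal independent set. -/
def IsBase (M : BingoMatroid α) (B : Finset α) : Prop :=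
  M.Indep B ∧ ∀ J : Finset α, M.Indep J → B ⊆ J → B = J

/-- A coloop is an element of the ground set contained in no circuit. -/
def IsColoop (M : BingoMatroid α) (e : α) : Prop :=
  e ∈ M.E ∧ ∀ C ∈ M.circuits, e ∉ C

/-- `D` is a circuit of the contraction `M/T`: a nonempty inclusion-minimal
member of `{C \ T : C a circuit of M}`. -/
def IsContractCircuit (M : BingoMatroid α) (T D : Finset α) : Prop :=
  D.Nonempty ∧ (∃ C ∈ M.circuits, D = C \ T) ∧
    ∀ C' ∈ M.circuits, (C' \ T).Nonempty → ¬ (C' \ T) ⊂ D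

end BingoMatroid

/-! ### Counting bijections -/

section Counting

variable {ι β : Type*} [Fintype ι] [DecidableEq ι] [Fintype β] [DecidableEq β]

/-- Any two ordered pairs of distinct points are the values at `i`, `j` equally often. -/
theorem card_equiv_apply_pair_eq {i j : ι} {a b c d : β} (hab : a ≠ b) (hcd : c ≠ d) :
    #{σ : ι ≃ β | (σ i, σ j) = (a, b)} = #{σ : ι ≃ β | (σ i, σ j) = (c, d)} := by
  obtain ⟨g, hg₁, hg₂⟩ := (MulAction.is_two_pretransitive_iff (G := Equiv.Perm β)).1
    (Equiv.Perm.isMultiplyPretransitive β 2) hab hcd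
  rw [Equiv.Perm.smul_def] at hg₁ hg₂
  refine card_equiv ((Equiv.refl ι).equivCongr g) fun σ => ?_
  simp [← hg₁, ← hg₂, Equiv.equivCongr]

theorem sum_offDiag_card_equiv (S : Finset β) {i j : ι} (hij : i ≠ j) :
    ∑ x ∈ S.offDiag, #{σ : ι ≃ β | (σ i, σ j) = x} =
      #{σ : ι ≃ β | σ i ∈ S ∧ σ j ∈ S} := by
  rw [card_eq_sum_card_fiberwise (f := fun σ : ι ≃ β => (σ i, σ j)) (t := S.offDiag)]
  · refine sum_congr rfl fun x hx => ?_
    rw [mem_offDiag] at hx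
    congr 1
    ext σ
    simp only [mem_filter, mem_univ, true_and]
    constructor
    · rintro rfl
      exact ⟨⟨hx.1, hx.2.1⟩, rfl⟩
    · exact fun h => h.2
  · intro σ hσ
    simpa [hij] using hσ

/-- A uniformly random bijection maps two given distinct points into `S` with probability
`#S (#S - 1) / (m (m - 1))`, where `m` is the size of the codomain. -/
theorem card_equiv_pair_mem (S : Finset β) {i j : ι} (hij : i ≠ j) :
    #(univ : Finset β).offDiag * #{σ : ι ≃ β | σ i ∈ S ∧ σ j ∈ S} =
      #S.offDiag * Fintype.card (ι ≃ β) := by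
  rcases S.offDiag.eq_empty_or_nonempty with h | ⟨⟨a, b⟩, hab⟩
  · rw [← sum_offDiag_card_equiv S hij, h]
    simp
  · have hne : a ≠ b := (mem_offDiag.1 hab).2.2
    have key (R : Finset β) : #{σ : ι ≃ β | σ i ∈ R ∧ σ j ∈ R} =
        #R.offDiag * #{σ : ι ≃ β | (σ i, σ j) = (a, b)} := by
      rw [← sum_offDiag_card_equiv R hij, sum_const_nat]
      rintro ⟨c, d⟩ hcd
      exact card_equiv_apply_pair_eq (mem_offDiag.1 hcd).2.2 hne
    have hall := key univ
    simp only [mem_univ, and_self, filter_true, card_univ (α := ι ≃ β)] at hall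
    rw [key S, hall]
    ring

variable [LinearOrder ι]

/-- For orders `σ` subject to a constraint that only sees which positions hold elements of `S`,
every element of `S` is equally likely to come last among `S`. -/
theorem card_mul_card_equiv_last (S : Finset β) (P : (ι ≃ β) → Prop) [DecidablePred P]
    (hP : ∀ (σ : ι ≃ β) (g : Equiv.Perm β), (∀ x, g x ∈ S ↔ x ∈ S) → (P (σ.trans g) ↔ P σ))
    {e : β} (he : e ∈ S) :
    #S * #{σ : ι ≃ β | (∀ x ∈ S, x ≠ e → σ.symm x < σ.symm e) ∧ P σ} =
      #{σ : ι ≃ β | P σ} := by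
  have hsymm : ∀ f ∈ S, #{σ : ι ≃ β | (∀ x ∈ S, x ≠ f → σ.symm x < σ.symm f) ∧ P σ} =
      #{σ : ι ≃ β | (∀ x ∈ S, x ≠ e → σ.symm x < σ.symm e) ∧ P σ} := by
    intro f hf
    have hS : ∀ x, Equiv.swap e f x ∈ S ↔ x ∈ S := by
      intro x
      rw [Equiv.swap_apply_def]
      split_ifs with h₁ h₂ <;> simp_all
    refine card_equiv ((Equiv.refl ι).equivCongr (Equiv.swap e f)) fun σ => ?_
    have hcongr : (Equiv.refl ι).equivCongr (Equiv.swap e f) σ = σ.trans (Equiv.swap e f) := rfl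
    simp only [mem_filter, mem_univ, true_and, hcongr, hP σ _ hS]
    refine and_congr_left fun _ => ?_
    simp only [Equiv.symm_trans_apply, Equiv.symm_swap, Equiv.swap_apply_left]
    constructor
    · intro h x hx hne
      refine h _ ((hS x).2 hx) fun h' => hne ?_
      rw [← Equiv.swap_apply_self e f x, h', Equiv.swap_apply_right]
    · intro h x hx hne
      have := h (Equiv.swap e f x) ((hS x).2 hx) fun h' => hne ?_
      · simpa using this
      · rw [← Equiv.swap_apply_self e f x, h', Equiv.swap_apply_left]
  rw [← sum_const_nat hsymm, ← card_biUnion]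
  · congr 1
    ext σ
    simp only [mem_biUnion, mem_filter, mem_univ, true_and]
    refine ⟨fun ⟨_, _, _, h⟩ => h, fun h => ?_⟩
    obtain ⟨m, hm, hmax⟩ := S.exists_max_image σ.symm ⟨e, he⟩
    exact ⟨m, hm, fun x hx hne =>
      lt_of_le_of_ne (hmax x hx) fun h' => hne (σ.symm.injective h'), h⟩
  · intro a ha b hb hab
    refine disjoint_left.2 fun σ hσa hσb => ?_
    simp only [mem_filter, mem_univ, true_and] at hσa hσb
    exact lt_asymm (hσa.1 b hb hab.symm) (hσb.1 a ha hab)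

end Counting

/-! ### Completion times -/

section HitTime

variable {α : Type*} {n : ℕ} {E : Finset α}

theorem hitTime_le_iff (σ : Fin n ≃ {x // x ∈ E}) {C : Finset α} (hC : C ⊆ E) {t : ℕ} :
    hitTime (fun i => (σ i : α)) C ≤ t ↔
      ∀ x : {x // x ∈ E}, x.1 ∈ C → (σ.symm x : ℕ) < t := by
  constructor
  · intro h x hx
    have hne : {t : ℕ | ∀ x ∈ C, ∃ i : Fin n, (i : ℕ) < t ∧ (σ i : α) = x}.Nonempty :=
      ⟨n, fun x hx => ⟨σ.symm ⟨x, hC hx⟩, Fin.is_lt _, by simp⟩⟩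
    obtain ⟨i, hi, hix⟩ := Nat.sInf_mem hne x hx
    have : σ.symm x = i := by rw [Equiv.symm_apply_eq]; exact Subtype.ext hix.symm
    rw [this]
    exact lt_of_lt_of_le hi h
  · exact fun h => Nat.sInf_le fun x hx => ⟨σ.symm ⟨x, hC hx⟩, h _ hx, by simp⟩

theorem hitTime_lt_hitTime_iff (σ : Fin n ≃ {x // x ∈ E}) {C C' : Finset α} (hC : C ⊆ E)
    (hC' : C' ⊆ E) :
    hitTime (fun i => (σ i : α)) C < hitTime (fun i => (σ i : α)) C' ↔
      ∃ y : {x // x ∈ E}, y.1 ∈ C' ∧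
        ∀ x : {x // x ∈ E}, x.1 ∈ C → σ.symm x < σ.symm y := by
  rw [← not_le, hitTime_le_iff σ hC']
  push Not
  simp only [hitTime_le_iff σ hC, Fin.lt_def]

end HitTime

/-! ### Winning orders in a direct sum of two uniform matroids -/

namespace BingoMatroid

variable {α : Type*} [DecidableEq α] {M : BingoMatroid α} {E₁ E₂ : Finset α}

theorem wins_iff (σ : Fin M.E.card ≃ {x // x ∈ M.E}) {C : Finset α} (hC : C ∈ M.circuits) :
    M.Wins σ C ↔ ∀ C' ∈ M.circuits, C' ≠ C → ∃ y : {x // x ∈ M.E}, y.1 ∈ C' ∧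
      ∀ x : {x // x ∈ M.E}, x.1 ∈ C → σ.symm x < σ.symm y :=
  forall₃_congr fun C' hC' _ =>
    hitTime_lt_hitTime_iff σ (M.subset_ground C hC) (M.subset_ground C' hC')

/-- The circuits are the sets `E₁ \ {e}` with `e ∈ E₁`, together with `E₂`: the matroid is
`U_{k-2,k} ⊕ U_{l-1,l}`. -/
def IsEraseSum (M : BingoMatroid α) (E₁ E₂ : Finset α) : Prop :=
  Disjoint E₁ E₂ ∧ M.E = E₁ ∪ E₂ ∧ ∀ C, C ∈ M.circuits ↔ (∃ e ∈ E₁, C = E₁.erase e) ∨ C = E₂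

namespace IsEraseSum

variable {p q : Fin M.E.card}

theorem mem_right_iff (h : M.IsEraseSum E₁ E₂) (x : {x // x ∈ M.E}) : x.1 ∈ E₂ ↔ x.1 ∉ E₁ := by
  have hx : x.1 ∈ E₁ ∨ x.1 ∈ E₂ := mem_union.1 (h.2.1 ▸ x.2)
  exact ⟨fun h₂ h₁ => disjoint_left.1 h.1 h₁ h₂, fun h₁ => hx.resolve_left h₁⟩

theorem erase_mem (h : M.IsEraseSum E₁ E₂) {e : α} (he : e ∈ E₁) : E₁.erase e ∈ M.circuits :=
  (h.2.2 _).2 (.inl ⟨e, he, rfl⟩)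

theorem right_mem (h : M.IsEraseSum E₁ E₂) : E₂ ∈ M.circuits := (h.2.2 _).2 (.inr rfl)

theorem erase_ne_right (h : M.IsEraseSum E₁ E₂) (e : α) (h₂ : E₂.Nonempty) : E₁.erase e ≠ E₂ := by
  rintro h'
  obtain ⟨x, hx⟩ := h₂
  exact disjoint_left.1 h.1 (mem_of_mem_erase (h' ▸ hx : x ∈ E₁.erase e)) hx

/-- `E₂` wins exactly when the last two values called both belong to `E₁`. -/
theorem wins_right_iff (h : M.IsEraseSum E₁ E₂) (hne₁ : E₁.Nonempty) (hne₂ : E₂.Nonempty)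
    (hp : (p : ℕ) + 2 = M.E.card) (hq : (q : ℕ) + 1 = M.E.card)
    (σ : Fin M.E.card ≃ {x // x ∈ M.E}) :
    M.Wins σ E₂ ↔ (σ p).1 ∈ E₁ ∧ (σ q).1 ∈ E₁ := by
  rw [wins_iff σ h.right_mem]
  constructor
  · intro hw
    have hlate : ∀ e ∈ E₁, ∃ y : {x // x ∈ M.E}, y.1 ≠ e ∧
        ∀ x : {x // x ∈ M.E}, x.1 ∈ E₂ → σ.symm x < σ.symm y := fun e he => by
      obtain ⟨y, hy, hy'⟩ := hw _ (h.erase_mem he) (h.erase_ne_right e hne₂)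
      exact ⟨y, ne_of_mem_erase hy, hy'⟩
    have hqE : (σ q).1 ∈ E₁ := by
      by_contra hn
      obtain ⟨e, he⟩ := hne₁
      obtain ⟨y, -, hy⟩ := hlate e he
      have := hy _ ((h.mem_right_iff _).2 hn)
      rw [Equiv.symm_apply_apply, Fin.lt_def] at this
      lia
    refine ⟨?_, hqE⟩
    by_contra hn
    obtain ⟨y, hye, hy⟩ := hlate _ hqE
    have := hy _ ((h.mem_right_iff _).2 hn)
    rw [Equiv.symm_apply_apply, Fin.lt_def] at this
    have hyq : σ.symm y = q := Fin.ext (by lia)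
    exact hye (by rw [← hyq, Equiv.apply_symm_apply])
  · rintro ⟨hpE, hqE⟩ C' hC' hne
    obtain ⟨e, he, rfl⟩ := ((h.2.2 _).1 hC').resolve_right hne
    have hlt : ∀ x : {x // x ∈ M.E}, x.1 ∈ E₂ → σ.symm x < p := by
      intro x hx
      rw [h.mem_right_iff] at hx
      have hxp : (σ.symm x : ℕ) ≠ p := fun h' => hx (by
        rwa [← Fin.ext h', Equiv.apply_symm_apply] at hpE)
      have hxq : (σ.symm x : ℕ) ≠ q := fun h' => hx (by
        rwa [← Fin.ext h', Equiv.apply_symm_apply] at hqE)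
      rw [Fin.lt_def]
      lia
    by_cases hqe : (σ q).1 = e
    · refine ⟨σ p, mem_erase.2 ⟨fun hpe => ?_, hpE⟩, by simpa using hlt⟩
      have : p = q := σ.injective (Subtype.ext (hpe.trans hqe.symm))
      lia
    · refine ⟨σ q, mem_erase.2 ⟨hqe, hqE⟩, fun x hx => (hlt x hx).trans ?_⟩
      rw [Equiv.symm_apply_apply, Fin.lt_def]
      lia

/-- `E₁ \ {e}` wins exactly when `e` is the last value of `E₁` to be called and `E₂` does not
win. -/
theorem wins_erase_iff (h : M.IsEraseSum E₁ E₂) (hne₂ : E₂.Nonempty)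
    (hp : (p : ℕ) + 2 = M.E.card) (hq : (q : ℕ) + 1 = M.E.card)
    (σ : Fin M.E.card ≃ {x // x ∈ M.E}) {e : {x // x ∈ M.E}} (he : e.1 ∈ E₁) :
    M.Wins σ (E₁.erase e) ↔ (∀ x : {x // x ∈ M.E}, x.1 ∈ E₁ → x ≠ e → σ.symm x < σ.symm e) ∧
      ¬ ((σ p).1 ∈ E₁ ∧ (σ q).1 ∈ E₁) := by
  constructor
  · intro hw
    constructor
    · intro x hx hxe
      have hne : E₁.erase x ≠ E₁.erase e := fun h' =>
        hxe (Subtype.ext (erase_injOn E₁ hx he h'))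
      obtain ⟨y, hy, hy'⟩ := (wins_iff σ (h.erase_mem he)).1 hw _ (h.erase_mem hx) hne
      have hye : y = e := by
        by_contra hye
        exact lt_irrefl _ (hy' y (mem_erase.2 ⟨fun h' => hye (Subtype.ext h'),
          mem_of_mem_erase hy⟩))
      rw [← hye]
      exact hy' x (mem_erase.2 ⟨fun h' => hxe (Subtype.ext h'), hx⟩)
    · rw [← h.wins_right_iff ⟨_, he⟩ hne₂ hp hq]
      intro hw'
      exact lt_asymm (hw _ h.right_mem (h.erase_ne_right _ hne₂).symm)
        (hw' _ (h.erase_mem he) (h.erase_ne_right _ hne₂))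
  · rintro ⟨hlast, hn⟩
    rw [wins_iff σ (h.erase_mem he)]
    have hlt : ∀ x : {x // x ∈ M.E}, x.1 ∈ E₁.erase e → σ.symm x < σ.symm e := fun x hx =>
      hlast x (mem_of_mem_erase hx) fun h' => ne_of_mem_erase hx (congrArg _ h')
    intro C' hC' hne
    rcases (h.2.2 _).1 hC' with ⟨f, hf, rfl⟩ | rfl
    · exact ⟨e, mem_erase.2 ⟨fun h' => hne (by rw [h']), he⟩, hlt⟩
    · by_cases hqE : (σ q).1 ∈ E₁
      · have hpE : (σ p).1 ∉ E₁ := fun hpE => hn ⟨hpE, hqE⟩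
        refine ⟨σ p, (h.mem_right_iff _).2 hpE, fun x hx => ?_⟩
        have hxe := hlt x hx
        have hxp : (σ.symm x : ℕ) ≠ p := fun h' => hpE (by
          rw [← Fin.ext h', Equiv.apply_symm_apply]
          exact mem_of_mem_erase hx)
        rw [Equiv.symm_apply_apply]
        rw [Fin.lt_def] at hxe ⊢
        lia
      · refine ⟨σ q, (h.mem_right_iff _).2 hqE, fun x hx => ?_⟩
        have hxq : (σ.symm x : ℕ) ≠ q := fun h' => hqE (by
          rw [← Fin.ext h', Equiv.apply_symm_apply]
          exact mem_of_mem_erase hx)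
        rw [Equiv.symm_apply_apply, Fin.lt_def]
        lia

end IsEraseSum

end BingoMatroid

theorem mem_powersetCard_iff_exists_erase {α : Type*} [DecidableEq α] {s C : Finset α} {k : ℕ}
    (hs : #s = k + 1) : C ∈ s.powersetCard k ↔ ∃ e ∈ s, C = s.erase e := by
  rw [mem_powersetCard]
  constructor
  · rintro ⟨hC, hk⟩
    obtain ⟨e, he⟩ := card_eq_one.1 (show #(s \ C) = 1 by rw [card_sdiff_of_subset hC]; lia)
    refine ⟨e, (mem_sdiff.1 (he ▸ mem_singleton_self e : e ∈ s \ C)).1, ?_⟩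
    rw [← sdiff_singleton_eq_erase, ← he, Finset.sdiff_sdiff_eq_self hC]
  · rintro ⟨e, he, rfl⟩
    exact ⟨erase_subset _ _, by rw [card_erase_of_mem he]; lia⟩

/-- for the direct sum `U_{4,6} ⊕ U_{8,9}` every circuit has
winning probability `1/7`; in particular this matroid is equitable. -/
theorem stmt13 {α : Type*} [DecidableEq α] (M : BingoMatroid α)
    (E1 E2 : Finset α) (hdisj : Disjoint E1 E2)
    (h1 : E1.card = 6) (h2 : E2.card = 9) (hE : M.E = E1 ∪ E2)
    (hcirc : M.circuits = E1.powersetCard 5 ∪ {E2}) :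
    ∀ C ∈ M.circuits, M.beta C = 1 / 7 := by
  intro C hC
  have h : M.IsEraseSum E1 E2 := ⟨hdisj, hE, fun C => by
    rw [hcirc, mem_union, mem_singleton, mem_powersetCard_iff_exists_erase h1]⟩
  have hn : #M.E = 15 := by rw [hE, card_union_of_disjoint hdisj, h1, h2]
  have hne₁ : E1.Nonempty := card_pos.1 (by lia)
  have hne₂ : E2.Nonempty := card_pos.1 (by lia)
  obtain ⟨p, hp⟩ : ∃ p : Fin #M.E, (p : ℕ) + 2 = #M.E := ⟨⟨13, by lia⟩, by simp [hn]⟩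
  obtain ⟨q, hq⟩ : ∃ q : Fin #M.E, (q : ℕ) + 1 = #M.E := ⟨⟨14, by lia⟩, by simp [hn]⟩
  have hpq : p ≠ q := by lia
  let S : Finset {x // x ∈ M.E} := {x | x.1 ∈ E1}
  have hS : ∀ x, x ∈ S ↔ x.1 ∈ E1 := fun x => by simp [S]
  have hScard : #S = 6 := by
    rw [← h1, ← card_map (Function.Embedding.subtype _)]
    congr 1
    ext x
    simp only [mem_map, hS, Function.Embedding.subtype_apply]
    constructor
    · rintro ⟨y, hy, rfl⟩
      exact hy
    · exact fun hx => ⟨⟨x, hE ▸ mem_union_left _ hx⟩, hx, rfl⟩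
  have htotal : Fintype.card (Fin #M.E ≃ {x // x ∈ M.E}) = Nat.factorial 15 := by
    rw [Fintype.card_equiv M.E.equivFin.symm, Fintype.card_fin, hn]
  have hground : Fintype.card {x // x ∈ M.E} = 15 := by rw [Fintype.card_coe, hn]
  have hpair := card_equiv_pair_mem S hpq
  rw [htotal, offDiag_card, offDiag_card, hScard, card_univ, hground] at hpair
  have hfac : (Nat.factorial 15 : ℚ) ≠ 0 := by exact_mod_cast (Nat.factorial_pos _).ne'
  suffices hcount : 7 * Nat.card {σ : Fin #M.E ≃ {x // x ∈ M.E} // M.Wins σ C} =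
      Nat.factorial 15 by
    rw [BingoMatroid.beta, congrArg Nat.factorial hn, div_eq_div_iff hfac (by norm_num), ← hcount]
    push_cast
    ring
  classical
  rw [Nat.card_eq_fintype_card, Fintype.card_subtype]
  rcases (h.2.2 C).1 hC with ⟨e, he, rfl⟩ | rfl
  · have hlast := card_mul_card_equiv_last S
      (fun σ : Fin #M.E ≃ {x // x ∈ M.E} => ¬ (σ p ∈ S ∧ σ q ∈ S))
      (fun σ g hg => by simp only [Equiv.trans_apply, hg])
      (e := ⟨e, hE ▸ mem_union_left _ he⟩) ((hS _).2 he)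
    have hcompl := card_filter_add_card_filter_not (s := univ)
      (fun σ : Fin #M.E ≃ {x // x ∈ M.E} => σ p ∈ S ∧ σ q ∈ S)
    rw [card_univ, htotal] at hcompl
    have hwins := h.wins_erase_iff hne₂ hp hq (e := ⟨e, hE ▸ mem_union_left _ he⟩)
    simp only [hwins _ he, ← hS]
    rw [hScard] at hlast
    lia
  · simp only [h.wins_right_iff hne₁ hne₂ hp hq, ← hS]
    lia
end

section
/- If M is a coloopless matroid of rank r on a finite ground set, then M has at least r + 1 distinct bases. -/
open Finset

namespace BingoMatroid

/-- Strong circuit elimination. -/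
theorem exists_mem_circuit_subset_union_erase {α : Type*} [DecidableEq α] (M : BingoMatroid α)
    {C D : Finset α} {e f : α} (hC : C ∈ M.circuits) (hD : D ∈ M.circuits)
    (hfC : f ∈ C) (hfD : f ∈ D) (heC : e ∈ C) (heD : e ∉ D) :
    ∃ C' ∈ M.circuits, e ∈ C' ∧ C' ⊆ (C ∪ D).erase f := by
  induction hn : (C ∪ D).card using Nat.strong_induction_on generalizing C D e f with
  | _ n ih =>
  subst hn
  obtain ⟨X, hX, hXsub⟩ := M.elimination C hC D hD (by rintro rfl; exact heD heC) f
    (mem_inter.2 ⟨hfC, hfD⟩)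
  rw [sdiff_singleton_eq_erase] at hXsub
  by_cases heX : e ∈ X
  · exact ⟨X, hX, heX, hXsub⟩
  have hfX : f ∉ X := fun h => notMem_erase f _ (hXsub h)
  have hXC : ¬ X ⊆ C := fun h => hfX (M.antichain X hX C hC h ▸ hfC)
  obtain ⟨g, hgX, hgC⟩ := not_subset.1 hXC
  have hXu : X ⊆ C ∪ D := hXsub.trans (erase_subset _ _)
  have hgD : g ∈ D := (mem_union.1 (hXu hgX)).resolve_left hgC
  have hlt : (D ∪ X).card < (C ∪ D).card := by
    refine card_lt_card ⟨union_subset subset_union_right hXu, fun h => ?_⟩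
    exact (mem_union.1 (h (mem_union_left _ heC))).elim heD heX
  obtain ⟨Y, hY, hfY, hYsub⟩ := ih _ hlt hD hX hgD hgX hfD hfX rfl
  have hYu : Y ⊆ C ∪ D := (hYsub.trans (erase_subset _ _)).trans
    (union_subset subset_union_right hXu)
  have heY : e ∉ Y := fun h =>
    (mem_union.1 (mem_of_mem_erase (hYsub h))).elim heD heX
  have hgY : g ∉ Y := fun h => notMem_erase g _ (hYsub h)
  have hlt' : (C ∪ Y).card < (C ∪ D).card := by
    refine card_lt_card ⟨union_subset subset_union_left hYu, fun h => ?_⟩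
    exact (mem_union.1 (h (mem_union_right _ hgD))).elim hgC hgY
  obtain ⟨Z, hZ, heZ, hZsub⟩ := ih _ hlt' hC hY hfC hfY heC heY rfl
  exact ⟨Z, hZ, heZ, hZsub.trans (erase_subset_erase f (union_subset subset_union_left hYu))⟩

theorem bddAbove_card_indep {α : Type*} [DecidableEq α] (M : BingoMatroid α) :
    BddAbove {k : ℕ | ∃ I : Finset α, M.Indep I ∧ I.card = k} :=
  ⟨M.E.card, by rintro _ ⟨I, hI, rfl⟩; exact card_le_card hI.1⟩

theorem Indep.card_le_rank {α : Type*} [DecidableEq α] {M : BingoMatroid α} {I : Finset α}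
    (hI : M.Indep I) : I.card ≤ M.rank :=
  le_csSup M.bddAbove_card_indep ⟨I, hI, rfl⟩

theorem exists_indep_card_eq_rank {α : Type*} [DecidableEq α] (M : BingoMatroid α) :
    ∃ B, M.Indep B ∧ B.card = M.rank := by
  refine Nat.sSup_mem (s := {k : ℕ | ∃ I : Finset α, M.Indep I ∧ I.card = k})
    ⟨0, ∅, ⟨empty_subset _, fun C hC h => ?_⟩, card_empty⟩ M.bddAbove_card_indep
  exact M.empty_not_mem (subset_empty.1 h ▸ hC)

theorem Indep.isBase_of_card_eq_rank {α : Type*} [DecidableEq α] {M : BingoMatroid α}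
    {B : Finset α} (hB : M.Indep B) (hcard : B.card = M.rank) : M.IsBase B :=
  ⟨hB, fun _ hJ hBJ => eq_of_subset_of_card_le hBJ (hcard ▸ hJ.card_le_rank)⟩

/-- An element lying in some circuit lies in a circuit with exactly one element outside a given
maximum independent set. -/
theorem Indep.exists_circuit_sdiff_eq_singleton {α : Type*} [DecidableEq α]
    {M : BingoMatroid α} {B : Finset α} {e : α} (hB : M.Indep B) (hcard : B.card = M.rank)
    (he : ∃ C ∈ M.circuits, e ∈ C) :
    ∃ C ∈ M.circuits, e ∈ C ∧ ∃ f, C \ B = {f} := by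
  obtain ⟨C₀, hC₀, heC₀⟩ := he
  obtain ⟨C, hC, hmin⟩ := exists_min_image (M.circuits.filter (e ∈ ·)) (fun C => (C \ B).card)
    ⟨C₀, mem_filter.2 ⟨hC₀, heC₀⟩⟩
  obtain ⟨hC, heC⟩ := mem_filter.1 hC
  refine ⟨C, hC, heC, ?_⟩
  obtain ⟨f, hfC, hfB⟩ := not_subset.1 (hB.2 C hC)
  have hdep : ¬ M.Indep (insert f B) := fun h => by
    have := h.card_le_rank
    rw [card_insert_of_notMem hfB] at this
    omega
  obtain ⟨D, hD, hDsub⟩ : ∃ D ∈ M.circuits, D ⊆ insert f B := by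
    by_contra! h
    exact hdep ⟨insert_subset (M.subset_ground C hC hfC) hB.1, h⟩
  have hfD : f ∈ D := by
    by_contra h
    exact hB.2 D hD ((subset_insert_iff_of_notMem h).1 hDsub)
  by_cases heD : e ∈ D
  · have hDB : D \ B ⊆ {f} := fun x hx => by
      have := hDsub (mem_sdiff.1 hx).1
      grind
    refine card_eq_one.1 (le_antisymm ?_ (card_pos.2 ⟨f, mem_sdiff.2 ⟨hfC, hfB⟩⟩))
    exact (hmin D (mem_filter.2 ⟨hD, heD⟩)).trans (card_le_card hDB)
  · obtain ⟨X, hX, heX, hXsub⟩ :=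
      M.exists_mem_circuit_subset_union_erase hC hD hfC hfD heC heD
    refine absurd (hmin X (mem_filter.2 ⟨hX, heX⟩)) (not_le.2 (card_lt_card ⟨?_, ?_⟩))
    · intro x hx
      have h1 := hXsub (mem_sdiff.1 hx).1
      have h2 := @hDsub x
      grind
    · intro h
      exact notMem_erase f _ (hXsub (mem_sdiff.1 (h (mem_sdiff.2 ⟨hfC, hfB⟩))).1)

theorem Indep.exists_isBase_sdiff_eq_singleton {α : Type*} [DecidableEq α]
    {M : BingoMatroid α} {B : Finset α} {e : α} (hB : M.Indep B) (hcard : B.card = M.rank)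
    (heB : e ∈ B) (he : ∃ C ∈ M.circuits, e ∈ C) :
    ∃ B', M.IsBase B' ∧ B \ B' = {e} := by
  obtain ⟨C, hC, heC, f, hf⟩ := hB.exists_circuit_sdiff_eq_singleton hcard he
  have hCB : ∀ x ∈ C, x ∉ B → x = f := fun x hxC hxB =>
    mem_singleton.1 (hf ▸ mem_sdiff.2 ⟨hxC, hxB⟩)
  obtain ⟨hfC, hfB⟩ := mem_sdiff.1 (hf ▸ mem_singleton_self f : f ∈ C \ B)
  have hfe : f ∉ B.erase e := fun h => hfB (mem_of_mem_erase h)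
  refine ⟨insert f (B.erase e), Indep.isBase_of_card_eq_rank ⟨?_, ?_⟩ ?_, ?_⟩
  · exact insert_subset (M.subset_ground C hC hfC) ((erase_subset _ _).trans hB.1)
  · intro D hD hDsub
    have hfD : f ∈ D := by
      by_contra h
      exact hB.2 D hD (((subset_insert_iff_of_notMem h).1 hDsub).trans (erase_subset _ _))
    have heD : e ∉ D := fun h => by
      have := hDsub h
      grind
    obtain ⟨X, hX, hXsub⟩ := M.elimination C hC D hD (by rintro rfl; exact heD heC) f
      (mem_inter.2 ⟨hfC, hfD⟩)
    refine hB.2 X hX fun x hx => ?_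
    have h1 := hXsub hx
    have h2 := @hDsub x
    have h3 := hCB x
    grind
  · rw [card_insert_of_notMem hfe, card_erase_add_one heB, hcard]
  · ext x
    grind

end BingoMatroid

/-- a coloopless matroid of rank `r` has at least `r + 1` bases. -/
theorem stmt16 {α : Type*} [DecidableEq α] (M : BingoMatroid α)
    (hcl : ∀ x ∈ M.E, ∃ C ∈ M.circuits, x ∈ C) :
    M.rank + 1 ≤ Set.ncard {B : Finset α | M.IsBase B} := by
  obtain ⟨B, hB, hcard⟩ := M.exists_indep_card_eq_rank
  choose! g hg hgB using fun e (he : e ∈ B) =>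
    hB.exists_isBase_sdiff_eq_singleton hcard he (hcl e (hB.1 he))
  have hinj : Set.InjOn g B := fun x hx y hy hxy => by
    rw [← singleton_inj, ← hgB x hx, ← hgB y hy, hxy]
  have hBg : B ∉ B.image g := fun h => by
    obtain ⟨e, he, heq⟩ := mem_image.1 h
    have := hgB e he
    simp [heq] at this
  have hfin : {B : Finset α | M.IsBase B}.Finite :=
    M.E.powerset.finite_toSet.subset fun _ hX => mem_coe.2 (mem_powerset.2 hX.1.1)
  calc M.rank + 1 = (insert B (B.image g)).card := by
        rw [card_insert_of_notMem hBg, card_image_of_injOn hinj, hcard]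
    _ = ((insert B (B.image g) : Finset (Finset α)) : Set (Finset α)).ncard :=
        (Set.ncard_coe_finset _).symm
    _ ≤ _ := Set.ncard_le_ncard (fun X hX => by
        rcases mem_insert.1 (mem_coe.1 hX) with rfl | hX
        · exact hB.isBase_of_card_eq_rank hcard
        · obtain ⟨e, he, rfl⟩ := mem_image.1 hX
          exact hg e he) hfin
end
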